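/- If G is a graph in obs(P1) that is not isomorphic to any of the 33 graphs in O, then: (1) every vertex of G has degree at least 2; (2) G has no bridge; and (3) every vertex of G of degree 2 is simplicial (its two neighbors are adjacent). -/

import Mathlib

open SimpleGraph

/-- `H` is a minor of `G` (branch-set definition): there is a family of connected, nonempty,
pairwise disjoint branch sets in `G`, indexed by the vertices of `H`, such that vertices
adjacent in `H` have an edge of `G` between their branch sets. -/
def IsMinorOf {W V : Type} (H : SimpleGraph W) (G : SimpleGraph V) : Prop :=
  ∃ f : W → Set V,
    (∀ w, (G.induce (f w)).Connected) ∧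
    (∀ ⦃w w' : W⦄, w ≠ w' → Disjoint (f w) (f w')) ∧
    (∀ ⦃w w' : W⦄, H.Adj w w' → ∃ a ∈ f w, ∃ b ∈ f w', G.Adj a b)

/-- A pseudoforest: every connected component contains at most one cycle, i.e. any two
cycles lying in the same connected component have the same edge set. -/
def Pseudoforest {V : Type} (G : SimpleGraph V) : Prop :=
  ∀ ⦃u v : V⦄ (c : G.Walk u u) (c' : G.Walk v v),
    c.IsCycle → c'.IsCycle → G.Reachable u v → ∀ e, e ∈ c.edges ↔ e ∈ c'.edges

/-- An apex-pseudoforest: removing at most one vertex yields a pseudoforest. -/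
def ApexPseudoforest {V : Type} (G : SimpleGraph V) : Prop :=
  ∃ s : Set V, s.Subsingleton ∧ Pseudoforest (G.induce sᶜ)

/-- `G` is a minor-obstruction for the class of apex-pseudoforests: `G` is not an
apex-pseudoforest but every proper minor of `G` is. -/
def ObsApexPseudoforest {V : Type} (G : SimpleGraph V) : Prop :=
  ¬ ApexPseudoforest G ∧
    ∀ (W : Type) [Finite W] (H : SimpleGraph W),
      IsMinorOf H G → IsEmpty (H ≃g G) → ApexPseudoforest H

/-- The simple graph on `Fin n` with the given list of (0-indexed) edges. -/
def mkGraph (n : ℕ) (E : List (ℕ × ℕ)) : SimpleGraph (Fin n) :=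
  SimpleGraph.fromRel fun a b => ((a : ℕ), (b : ℕ)) ∈ E

/-- Obstruction 1: two disjoint diamonds. -/
def O1 : SimpleGraph (Fin 8) :=
  mkGraph 8 [(0,1),(0,2),(0,3),(1,2),(1,3),(4,5),(4,6),(4,7),(5,6),(5,7)]
/-- Obstruction 2: two disjoint butterflies. -/
def O2 : SimpleGraph (Fin 10) :=
  mkGraph 10 [(0,1),(0,2),(1,2),(0,3),(0,4),(3,4),(5,6),(5,7),(6,7),(5,8),(5,9),(8,9)]
/-- Obstruction 3: a diamond plus a butterfly. -/
def O3 : SimpleGraph (Fin 9) :=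
  mkGraph 9 [(0,1),(0,2),(0,3),(1,2),(1,3),(4,5),(4,6),(5,6),(4,7),(4,8),(7,8)]
def O4 : SimpleGraph (Fin 8) :=
  mkGraph 8 [(0,1),(0,2),(1,2),(2,3),(2,4),(3,4),(3,5),(4,5),(5,6),(5,7),(6,7)]
def O5 : SimpleGraph (Fin 8) :=
  mkGraph 8 [(0,1),(0,2),(1,2),(2,3),(2,4),(3,4),(3,5),(4,6),(5,6),(5,7),(6,7)]
def O6 : SimpleGraph (Fin 8) :=
  mkGraph 8 [(0,1),(0,2),(1,2),(2,3),(2,4),(3,4),(3,5),(4,5),(3,6),(5,6),(4,7),(5,7)]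
def O7 : SimpleGraph (Fin 7) :=
  mkGraph 7 [(0,1),(0,6),(1,6),(2,3),(2,4),(2,5),(3,4),(3,5),(4,6),(5,6)]
def O8 : SimpleGraph (Fin 7) :=
  mkGraph 7 [(0,1),(0,2),(1,2),(2,3),(2,4),(2,5),(3,4),(3,5),(4,5),(4,6),(5,6)]
def O9 : SimpleGraph (Fin 9) :=
  mkGraph 9 [(0,1),(0,2),(1,2),(2,3),(2,4),(3,4),(3,5),(4,5),(2,6),(4,6),(2,7),(3,7),(3,8),(4,8)]
def O10 : SimpleGraph (Fin 9) :=
  mkGraph 9 [(0,1),(1,2),(2,3),(3,0),(0,4),(1,4),(1,5),(2,5),(2,6),(3,6),(0,7),(0,8),(7,8)]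
def O11 : SimpleGraph (Fin 9) :=
  mkGraph 9 [(0,1),(0,2),(1,2),(3,4),(3,5),(4,5),(6,7),(6,8),(7,8),(2,3),(1,8),(4,8)]
def O12 : SimpleGraph (Fin 9) :=
  mkGraph 9 [(0,1),(0,2),(1,2),(3,4),(3,5),(4,5),(6,7),(6,8),(7,8),(2,3),(2,7),(3,6)]
def O13 : SimpleGraph (Fin 9) :=
  mkGraph 9 [(0,1),(0,2),(1,2),(3,4),(3,5),(4,5),(6,7),(6,8),(7,8),(2,3),(2,8),(3,8)]
def O14 : SimpleGraph (Fin 8) :=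
  mkGraph 8 [(0,1),(0,2),(1,2),(1,4),(2,3),(2,4),(3,4),(3,5),(4,5),(1,6),(1,7),(6,7)]
def O15 : SimpleGraph (Fin 9) :=
  mkGraph 9 [(0,1),(0,2),(1,2),(2,3),(2,4),(3,4),(4,5),(4,6),(5,6),(6,7),(6,8),(7,8),(2,6)]
def O16 : SimpleGraph (Fin 6) :=
  mkGraph 6 [(0,2),(0,3),(0,4),(0,5),(1,2),(1,3),(1,4),(1,5),(2,3),(4,5)]
def O17 : SimpleGraph (Fin 6) :=
  mkGraph 6 [(0,1),(1,3),(3,2),(2,0),(4,0),(4,1),(4,2),(4,3),(5,0),(5,1)]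
def O18 : SimpleGraph (Fin 8) :=
  mkGraph 8 [(0,1),(1,2),(2,3),(3,0),(4,0),(4,1),(5,1),(5,2),(6,2),(6,3),(7,3),(7,0)]
def O19 : SimpleGraph (Fin 7) :=
  mkGraph 7 [(0,2),(0,3),(1,2),(1,3),(2,3),(0,4),(4,1),(5,0),(5,4),(6,4),(6,1)]
def O20 : SimpleGraph (Fin 6) :=
  mkGraph 6 [(1,2),(1,4),(1,5),(2,4),(2,5),(4,5),(0,1),(0,4),(2,3),(3,5)]
def O21 : SimpleGraph (Fin 7) :=
  mkGraph 7 [(0,1),(0,3),(0,4),(1,3),(1,4),(3,5),(4,5),(1,2),(2,4),(3,6),(5,6)]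
def O22 : SimpleGraph (Fin 8) :=
  mkGraph 8 [(0,1),(0,3),(1,4),(3,4),(1,2),(2,4),(7,0),(7,3),(5,7),(5,0),(6,7),(6,3)]
def O23 : SimpleGraph (Fin 7) :=
  mkGraph 7 [(2,3),(2,4),(2,6),(3,4),(3,6),(4,6),(5,3),(5,4),(0,2),(0,3),(1,2),(1,4)]
def O24 : SimpleGraph (Fin 7) :=
  mkGraph 7 [(0,1),(0,2),(1,2),(1,3),(2,4),(3,5),(3,6),(4,5),(4,6),(5,6)]
def O25 : SimpleGraph (Fin 8) :=
  mkGraph 8 [(0,1),(0,3),(1,3),(1,2),(1,5),(2,5),(1,7),(2,7),(3,4),(4,5),(3,5),(3,6),(5,6)]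
def O26 : SimpleGraph (Fin 9) :=
  mkGraph 9 [(2,3),(2,4),(3,4),(5,3),(5,4),(8,3),(8,4),(0,2),(0,3),(7,2),(7,3),(1,2),(1,4),(6,2),(6,4)]
def O27 : SimpleGraph (Fin 8) :=
  mkGraph 8 [(0,2),(1,2),(0,3),(2,3),(1,6),(2,6),(3,4),(6,7),(4,5),(5,7),(3,7),(4,7)]
def O28 : SimpleGraph (Fin 7) :=
  mkGraph 7 [(0,1),(0,2),(1,2),(1,3),(1,5),(3,5),(3,4),(3,6),(4,6),(2,5),(5,6)]
def O29 : SimpleGraph (Fin 9) :=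
  mkGraph 9 [(0,1),(0,2),(1,2),(3,4),(3,5),(4,5),(6,7),(6,8),(7,8),(2,3),(1,7),(4,6)]
def O30 : SimpleGraph (Fin 8) :=
  mkGraph 8 [(0,1),(0,2),(1,2),(3,4),(3,5),(4,5),(6,7),(1,6),(4,6),(0,7),(5,7)]
/-- Obstruction 31: the prism. -/
def O31 : SimpleGraph (Fin 6) :=
  mkGraph 6 [(0,1),(0,2),(1,2),(3,4),(3,5),(4,5),(0,3),(1,4),(2,5)]
/-- Obstruction 32: `K₃,₃`. -/
def O32 : SimpleGraph (Fin 6) :=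
  mkGraph 6 [(0,3),(0,4),(0,5),(1,3),(1,4),(1,5),(2,3),(2,4),(2,5)]
/-- Obstruction 33: `K₅` minus one edge. -/
def O33 : SimpleGraph (Fin 5) :=
  mkGraph 5 [(0,1),(0,2),(0,3),(0,4),(1,2),(1,3),(1,4),(2,3),(2,4)]

/-- The list `O` of the 33 obstructions. -/
def OList : List ((n : ℕ) × SimpleGraph (Fin n)) :=
  [⟨8, O1⟩, ⟨10, O2⟩, ⟨9, O3⟩, ⟨8, O4⟩, ⟨8, O5⟩, ⟨8, O6⟩, ⟨7, O7⟩, ⟨7, O8⟩, ⟨9, O9⟩,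
   ⟨9, O10⟩, ⟨9, O11⟩, ⟨9, O12⟩, ⟨9, O13⟩, ⟨8, O14⟩, ⟨9, O15⟩, ⟨6, O16⟩, ⟨6, O17⟩,
   ⟨8, O18⟩, ⟨7, O19⟩, ⟨6, O20⟩, ⟨7, O21⟩, ⟨8, O22⟩, ⟨7, O23⟩, ⟨7, O24⟩, ⟨8, O25⟩,
   ⟨9, O26⟩, ⟨8, O27⟩, ⟨7, O28⟩, ⟨9, O29⟩, ⟨8, O30⟩, ⟨6, O31⟩, ⟨6, O32⟩, ⟨5, O33⟩]

/-- `G` is isomorphic to one of the 33 graphs in `O`. -/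
def InO {V : Type} (G : SimpleGraph V) : Prop :=
  ∃ H ∈ OList, Nonempty (G ≃g H.2)

theorem SimpleGraph.IsAcyclic.exists_parent {V : Type} {F : SimpleGraph V} (hF : F.IsAcyclic)
    (r : V) : ∃ p : V → V, ∀ a b, F.Adj a b → F.Reachable a r →
      (a ≠ r ∧ p a = b) ∨ (b ≠ r ∧ p b = a) := by
  classical
  have hex : ∀ w, F.Reachable w r → ∃ q : F.Walk w r, q.IsPath :=
    fun w h => h.exists_isPath
  choose q hq using hex
  refine ⟨fun w => if h : F.Reachable w r then (q w h).snd else w, fun a b hab ha => ?_⟩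
  have hb : F.Reachable b r := hab.symm.reachable.trans ha
  have huniq : ∀ {w} (p₁ p₂ : F.Walk w r), p₁.IsPath → p₂.IsPath → p₁ = p₂ := fun p₁ p₂ h₁ h₂ =>
    congrArg Subtype.val ((hF.subsingleton_path _ _).elim ⟨p₁, h₁⟩ ⟨p₂, h₂⟩)
  have hcons : ∀ {x y} (h : F.Adj x y) (p : F.Walk y r), (Walk.cons h p).IsPath → x ≠ r := by
    rintro x y h p hp rfl
    simp at hp
  simp only [ha, hb, dif_pos]
  by_cases hmem : b ∈ (q a ha).support
  · left
    have h := hF.path_concat (hq b hb).reverse (hq a ha).reverse hab.symm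
      (by simpa using hmem)
    have h' : q a ha = Walk.cons hab (q b hb) := by
      rw [← Walk.reverse_reverse (q a ha), h, Walk.reverse_concat, Walk.reverse_reverse]
    exact ⟨hcons hab (q b hb) (h' ▸ hq a ha), by rw [h', Walk.snd_cons]⟩
  · right
    have hp : (Walk.cons hab.symm (q a ha)).IsPath := (Walk.cons_isPath_iff _ _).2 ⟨hq a ha, hmem⟩
    exact ⟨hcons _ _ hp, by rw [huniq _ _ (hq b hb) hp, Walk.snd_cons]⟩

theorem exists_cycle_of_spanning_forest {V : Type} {G F : SimpleGraph V} (hle : F ≤ G)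
    (hreach : F.Reachable = G.Reachable) {a b : V} (hab : G.Adj a b) (hF : ¬ F.Adj a b) :
    ∃ c : G.Walk a a, c.IsCycle ∧ s(a, b) ∈ c.edges ∧
      ∀ e ∈ c.edges, e = s(a, b) ∨ e ∈ F.edgeSet := by
  have hr : F.Reachable b a := by rw [hreach]; exact hab.symm.reachable
  obtain ⟨q, hq⟩ := hr.exists_isPath
  refine ⟨Walk.cons hab (q.mapLe hle), ?_, by simp, ?_⟩
  · rw [Walk.cons_isCycle_iff]
    refine ⟨hq.mapLe hle, fun h => hF ?_⟩
    rw [Walk.edges_mapLe_eq_edges] at h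
    exact q.adj_of_mem_edges h
  · intro e he
    rw [Walk.edges_cons, List.mem_cons, Walk.edges_mapLe_eq_edges] at he
    exact he.imp id fun h => q.edges_subset_edgeSet h

/-- `f` orients every edge of `G` inside `S` away from one of its ends, and each vertex is the tail
of at most one edge. -/
def OrientableOn {V : Type} (G : SimpleGraph V) (S : Set V) : Prop :=
  ∃ f : V → V, ∀ ⦃a b⦄, a ∈ S → b ∈ S → G.Adj a b → f a = b ∨ f b = a

theorem Pseudoforest.orientableOn_univ {V : Type} {G : SimpleGraph V} (hG : Pseudoforest G) :
    OrientableOn G Set.univ := by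
  classical
  obtain ⟨F, -, hle, hF, hreach⟩ :=
    G.exists_isAcyclic_reachable_eq_le_of_le_of_isAcyclic bot_le isAcyclic_bot
  have huniq : ∀ a b c d, G.Adj a b → ¬ F.Adj a b → G.Adj c d → ¬ F.Adj c d →
      G.Reachable a c → s(a, b) = s(c, d) := by
    intro a b c d hab hab' hcd hcd' hac
    obtain ⟨w, hw, hmem, -⟩ := exists_cycle_of_spanning_forest hle hreach hab hab'
    obtain ⟨w', hw', -, hsub⟩ := exists_cycle_of_spanning_forest hle hreach hcd hcd'
    exact (hsub _ ((hG w w' hw hw' hac _).1 hmem)).resolve_right hab'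
  have hroot : ∀ C : G.ConnectedComponent, ∃ r v, G.connectedComponentMk r = C ∧
      ∀ a b, G.connectedComponentMk a = C → G.Adj a b → ¬ F.Adj a b → s(a, b) = s(r, v) := by
    intro C
    by_cases h : ∃ a b, G.connectedComponentMk a = C ∧ G.Adj a b ∧ ¬ F.Adj a b
    · obtain ⟨r, v, hr, hrv, hrv'⟩ := h
      exact ⟨r, v, hr, fun a b ha hab hab' => huniq a b r v hab hab' hrv hrv'
        (ConnectedComponent.exact (ha.trans hr.symm))⟩
    · push Not at h
      obtain ⟨r, hr⟩ := C.exists_rep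
      exact ⟨r, r, hr, fun a b ha hab hab' => absurd (h a b ha hab) hab'⟩
  choose r v hr hrv using hroot
  choose p hp using hF.exists_parent
  refine ⟨fun w => if w = r (G.connectedComponentMk w) then v (G.connectedComponentMk w)
    else p (r (G.connectedComponentMk w)) w, fun a b _ _ hab => ?_⟩
  have hC : G.connectedComponentMk b = G.connectedComponentMk a :=
    ConnectedComponent.sound hab.symm.reachable
  simp only [hC]
  by_cases hFab : F.Adj a b
  · have hra : F.Reachable a (r (G.connectedComponentMk a)) := by
      rw [hreach]; exact ConnectedComponent.exact (hr _).symm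
    rcases hp (r (G.connectedComponentMk a)) a b hFab hra with ⟨h₁, h₂⟩ | ⟨h₁, h₂⟩
    · left; rw [if_neg h₁, h₂]
    · right; rw [if_neg h₁, h₂]
  · have h := hrv _ a b rfl hab hFab
    rw [Sym2.eq_iff] at h
    grind

theorem periodic_orbit {V : Type} {f : V → V} {g : ℕ → V} {n : ℕ} (hn : 0 < n)
    (hper : ∀ i, g (i + n) = g i) (hne : ∀ i, g (i + 2) ≠ g i)
    (hf : ∀ i, f (g i) = g (i + 1) ∨ f (g (i + 1)) = g i) (j : ℕ) :
    (∃ i, f (g j) = g i) ∧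
      ∀ e, (∃ i, e = s(g i, g (i + 1))) ↔ ∃ k, e = s(f^[k] (g j), f^[k + 1] (g j)) := by
  have hmul : ∀ k i, g (i + n * k) = g i := by
    intro k
    induction k with
    | zero => simp
    | succ k ih => intro i; rw [Nat.mul_succ, ← Nat.add_assoc, hper, ih]
  by_cases hfwd : ∃ i, f (g i) = g (i + 1)
  · obtain ⟨i₀, hi₀⟩ := hfwd
    have hback : ∀ i, f (g (i + 1)) = g (i + 2) → f (g i) = g (i + 1) := by
      intro i hi
      rcases hf i with h | h
      · exact h
      · exact absurd (hi.symm.trans h) (hne i)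
    have hback' : ∀ k i, f (g (i + k)) = g (i + k + 1) → f (g i) = g (i + 1) := by
      intro k
      induction k with
      | zero => exact fun i h => h
      | succ k ih => exact fun i h => ih i (hback _ h)
    have hall : ∀ i, f (g i) = g (i + 1) := by
      intro i
      have hle : i ≤ i₀ + n * i := (Nat.le_mul_of_pos_left i hn).trans (Nat.le_add_left _ _)
      obtain ⟨k, hk⟩ := Nat.exists_eq_add_of_le hle
      apply hback' k i
      rw [← hk, hmul, hi₀, Nat.add_right_comm, hmul]
    have hiter : ∀ k, f^[k] (g j) = g (j + k) := by
      intro k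
      induction k with
      | zero => rfl
      | succ k ih => rw [Function.iterate_succ_apply', ih, hall, Nat.add_assoc]
    refine ⟨⟨_, hall j⟩, fun e => ⟨?_, ?_⟩⟩
    · rintro ⟨i, rfl⟩
      have hle : j ≤ i + n * j := (Nat.le_mul_of_pos_left j hn).trans (Nat.le_add_left _ _)
      obtain ⟨k, hk⟩ := Nat.exists_eq_add_of_le hle
      refine ⟨k, ?_⟩
      rw [hiter, hiter, ← Nat.add_assoc, ← hk, hmul, Nat.add_right_comm, hmul]
    · rintro ⟨k, rfl⟩
      exact ⟨j + k, by rw [hiter, hiter, Nat.add_assoc]⟩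
  · push Not at hfwd
    have hall : ∀ i, f (g (i + 1)) = g i := fun i => (hf i).resolve_left (hfwd i)
    have hiter : ∀ k i, f^[k] (g (i + k)) = g i := by
      intro k
      induction k with
      | zero => exact fun i => rfl
      | succ k ih => intro i; rw [Function.iterate_succ_apply, ← Nat.add_assoc, hall, ih]
    have key' : ∀ i m k, j + n * m = i + 1 + k →
        s(f^[k] (g j), f^[k + 1] (g j)) = s(g i, g (i + 1)) := by
      intro i m k h
      have h₁ : f^[k] (g j) = g (i + 1) := by rw [← hiter k (i + 1), ← h, hmul]
      rw [Function.iterate_succ_apply', h₁, hall, Sym2.eq_swap]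
    refine ⟨?_, fun e => ⟨?_, ?_⟩⟩
    · obtain ⟨m, rfl⟩ : ∃ m, n = m + 1 := ⟨n - 1, by omega⟩
      exact ⟨j + m, by rw [← hper j, ← Nat.add_assoc, hall]⟩
    · rintro ⟨i, rfl⟩
      have hle : i + 1 ≤ j + n * (i + 1) :=
        (Nat.le_mul_of_pos_left _ hn).trans (Nat.le_add_left _ _)
      obtain ⟨k, hk⟩ := Nat.exists_eq_add_of_le hle
      exact ⟨k, (key' i _ k hk).symm⟩
    · rintro ⟨k, rfl⟩
      have hle : k + 1 ≤ j + n * (k + 1) :=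
        (Nat.le_mul_of_pos_left _ hn).trans (Nat.le_add_left _ _)
      obtain ⟨i, hi⟩ := Nat.exists_eq_add_of_le hle
      exact ⟨i, key' i (k + 1) k (by omega)⟩

theorem SimpleGraph.Walk.IsCycle.exists_periodic {V : Type} {G : SimpleGraph V} {u : V}
    {c : G.Walk u u} (hc : c.IsCycle) :
    ∃ (g : ℕ → V) (n : ℕ), 0 < n ∧ g 0 = u ∧ (∀ i, g (i + n) = g i) ∧ (∀ i, g (i + 2) ≠ g i) ∧
      (∀ i, G.Adj (g i) (g (i + 1))) ∧ ∀ e, e ∈ c.edges ↔ ∃ i, e = s(g i, g (i + 1)) := by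
  have h3 := hc.three_le_length
  have hpos : 0 < c.length := by omega
  have hstep : ∀ i, c.getVert ((i + 1) % c.length) = c.getVert (i % c.length + 1) := by
    intro i
    rw [Nat.add_mod, Nat.mod_eq_of_lt (by omega : 1 < c.length)]
    have hlt := Nat.mod_lt i hpos
    rcases Nat.lt_or_ge (i % c.length + 1) c.length with h | h
    · rw [Nat.mod_eq_of_lt h]
    · have h' : i % c.length + 1 = c.length := by omega
      rw [h', Nat.mod_self, Walk.getVert_zero, Walk.getVert_length]
  refine ⟨fun i => c.getVert (i % c.length), c.length, hpos, by simp, by simp, ?_, ?_, ?_⟩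
  · intro i h
    have h' := hc.getVert_injOn' (by have := Nat.mod_lt (i + 2) hpos; simp; omega)
      (by have := Nat.mod_lt i hpos; simp; omega) h
    have h2 : (c.length : ℤ) ∣ ((i + 2 : ℕ) : ℤ) - (i : ℕ) := Nat.modEq_iff_dvd.1 (Eq.symm h')
    have h2' : (c.length : ℤ) ∣ ((2 : ℕ) : ℤ) := by simpa using h2
    have := Nat.le_of_dvd (by norm_num) (Int.natCast_dvd_natCast.1 h2')
    omega
  · intro i
    simp only [hstep]
    exact c.adj_getVert_succ (Nat.mod_lt i hpos)
  · intro e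
    induction e with | h x y => ?_
    rw [Walk.mk_mem_edges_iff_exists]
    constructor
    · rintro ⟨i, hi, h⟩
      exact ⟨i, by simp only [hstep, Nat.mod_eq_of_lt hi]; exact h.symm⟩
    · rintro ⟨i, h⟩
      exact ⟨i % c.length, Nat.mod_lt i hpos, by simp only [hstep] at h; exact h.symm⟩

theorem OrientableOn.pseudoforest {V : Type} {G : SimpleGraph V}
    (hG : OrientableOn G Set.univ) : Pseudoforest G := by
  obtain ⟨f, hf⟩ := hG
  intro u v c c' hc hc' huv e
  have hiter : ∃ m n, f^[m] u = f^[n] v := by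
    obtain ⟨w⟩ := huv
    clear hc hc' c c'
    induction w with
    | nil => exact ⟨0, 0, rfl⟩
    | @cons a b d hab w ih =>
      obtain ⟨m, n, h⟩ := ih
      rcases hf (Set.mem_univ a) (Set.mem_univ b) hab with h' | h'
      · exact ⟨m + 1, n, by rw [Function.iterate_succ_apply, h', h]⟩
      · exact ⟨m, n + 1, by
          rw [Function.iterate_succ_apply', ← h, ← h', ← Function.iterate_succ_apply,
            Function.iterate_succ_apply']⟩
  have key : ∀ (x : V) (d : G.Walk x x), d.IsCycle → ∀ m e,
      e ∈ d.edges ↔ ∃ k, e = s(f^[k] (f^[m] x), f^[k + 1] (f^[m] x)) := by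
    intro x d hd m e
    obtain ⟨g, n, hn, h0, hper, hne, hadj, hedges⟩ := hd.exists_periodic
    have horb := periodic_orbit (f := f) hn hper hne
      fun i => hf (Set.mem_univ _) (Set.mem_univ _) (hadj i)
    have hrange : ∀ m, ∃ j, f^[m] x = g j := by
      intro m
      induction m with
      | zero => exact ⟨0, h0.symm⟩
      | succ m ih =>
        obtain ⟨j, hj⟩ := ih
        obtain ⟨i, hi⟩ := (horb j).1
        exact ⟨i, by rw [Function.iterate_succ_apply', hj, hi]⟩
    obtain ⟨j, hj⟩ := hrange m
    rw [hedges, (horb j).2, hj]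
  obtain ⟨m, n, h⟩ := hiter
  rw [key u c hc m, key v c' hc' n, h]

theorem OrientableOn.exists_extension {V : Type} {T : Set V} {H : SimpleGraph T} {s : Set T}
    (h : OrientableOn H s) : ∃ F : V → V, ∀ a b (ha : a ∈ T) (hb : b ∈ T),
      ⟨a, ha⟩ ∈ s → ⟨b, hb⟩ ∈ s → H.Adj ⟨a, ha⟩ ⟨b, hb⟩ → F a = b ∨ F b = a := by
  classical
  obtain ⟨f, hf⟩ := h
  refine ⟨fun a => if h : a ∈ T then f ⟨a, h⟩ else a, fun a b ha hb has hbs hab => ?_⟩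
  simpa [ha, hb, Subtype.ext_iff] using hf has hbs hab

theorem orientableOn_induce_iff {V : Type} {G : SimpleGraph V} {S : Set V} :
    OrientableOn (G.induce S) Set.univ ↔ OrientableOn G S := by
  classical
  constructor
  · intro h
    obtain ⟨F, hF⟩ := h.exists_extension
    exact ⟨F, fun a b ha hb hab => hF a b ha hb trivial trivial hab⟩
  · rintro ⟨f, hf⟩
    refine ⟨fun a => if h : f a ∈ S then ⟨f a, h⟩ else a, fun a b _ _ hab => ?_⟩
    have ha := a.2
    have hb := b.2
    rcases hf a.2 b.2 hab with h | h
    · left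
      simp [h, hb]
    · right
      simp [h, ha]

theorem apexPseudoforest_iff {V : Type} {G : SimpleGraph V} :
    ApexPseudoforest G ↔ ∃ s : Set V, s.Subsingleton ∧ OrientableOn G sᶜ :=
  exists_congr fun _ => and_congr_right fun _ =>
    ⟨fun h => orientableOn_induce_iff.1 h.orientableOn_univ,
      fun h => (orientableOn_induce_iff.2 h).pseudoforest⟩

theorem induce_singleton_connected {V : Type} (G : SimpleGraph V) (v : V) :
    (G.induce {v}).Connected := by
  rw [connected_iff]
  exact ⟨Preconnected.of_subsingleton, ⟨⟨v, rfl⟩⟩⟩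

theorem IsMinorOf.trans {A B C : Type} {H : SimpleGraph A} {K : SimpleGraph B}
    {L : SimpleGraph C} (hHK : IsMinorOf H K) (hKL : IsMinorOf K L) : IsMinorOf H L := by
  obtain ⟨f, hfc, hfd, hfa⟩ := hHK
  obtain ⟨g, hgc, hgd, hga⟩ := hKL
  have hdisj : ∀ {x b b'}, x ∈ g b → x ∈ g b' → b = b' := fun hx hx' => by
    by_contra hne
    exact Set.disjoint_left.1 (hgd hne) hx hx'
  refine ⟨fun w => ⋃ b ∈ f w, g b, fun w => ?_, fun w w' hw => ?_, fun w w' hw => ?_⟩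
  · have hsub : ∀ b ∈ f w, g b ⊆ ⋃ b ∈ f w, g b := fun b hb => Set.subset_biUnion_of_mem hb
    have hwalk : ∀ {b b' : f w} (_ : (K.induce (f w)).Walk b b') (x y : ⋃ b ∈ f w, g b),
        (x : C) ∈ g b → (y : C) ∈ g b' → (L.induce (⋃ b ∈ f w, g b)).Reachable x y := by
      have hsame : ∀ (b : f w) (x y : ⋃ b ∈ f w, g b), (x : C) ∈ g b → (y : C) ∈ g b →
          (L.induce (⋃ b ∈ f w, g b)).Reachable x y := fun b x y hx hy =>
        ((hgc b).preconnected ⟨x, hx⟩ ⟨y, hy⟩).map (induceHomOfLE _ (hsub b b.2)).toHom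
      intro b b' p
      induction p with
      | nil => exact hsame _
      | @cons b₁ b₂ b₃ h p ih =>
        intro x y hx hy
        obtain ⟨z, hz, z', hz', hadj⟩ := hga h
        refine (hsame b₁ x ⟨z, hsub _ b₁.2 hz⟩ hx hz).trans ?_
        have hstep : (L.induce (⋃ b ∈ f w, g b)).Adj ⟨z, hsub _ b₁.2 hz⟩
          ⟨z', hsub _ b₂.2 hz'⟩ := hadj
        exact hstep.reachable.trans (ih _ y hz' hy)
    rw [connected_iff]
    refine ⟨fun x y => ?_, ?_⟩
    · obtain ⟨b, hb, hx⟩ := Set.mem_iUnion₂.1 x.2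
      obtain ⟨b', hb', hy⟩ := Set.mem_iUnion₂.1 y.2
      obtain ⟨p⟩ := (hfc w).preconnected ⟨b, hb⟩ ⟨b', hb'⟩
      exact hwalk p x y hx hy
    · obtain ⟨b⟩ := (hfc w).nonempty
      obtain ⟨x⟩ := (hgc b).nonempty
      exact ⟨⟨x, hsub b b.2 x.2⟩⟩
  · rw [Set.disjoint_left]
    intro x hx hx'
    obtain ⟨b, hb, hxb⟩ := Set.mem_iUnion₂.1 hx
    obtain ⟨b', hb', hxb'⟩ := Set.mem_iUnion₂.1 hx'
    exact Set.disjoint_left.1 (hfd hw) hb (hdisj hxb hxb' ▸ hb')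
  · obtain ⟨b, hb, b', hb', hbb⟩ := hfa hw
    obtain ⟨x, hx, y, hy, hxy⟩ := hga hbb
    exact ⟨x, Set.mem_biUnion hb hx, y, Set.mem_biUnion hb' hy, hxy⟩

theorem isMinorOf_of_injective {A B : Type} {H : SimpleGraph A} {K : SimpleGraph B} (φ : A → B)
    (hφ : Function.Injective φ) (hadj : ∀ a b, H.Adj a b → K.Adj (φ a) (φ b)) :
    IsMinorOf H K :=
  ⟨fun a => {φ a}, fun _ => induce_singleton_connected K _,
    fun _ _ h => Set.disjoint_singleton.2 (hφ.ne h),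
    fun a b h => ⟨φ a, rfl, φ b, rfl, hadj a b h⟩⟩

theorem isMinorOf_induce {V : Type} (G : SimpleGraph V) (S : Set V) :
    IsMinorOf (G.induce S) G :=
  isMinorOf_of_injective (↑) Subtype.val_injective fun _ _ h => h

theorem isMinorOf_sum {A B V : Type} {H : SimpleGraph A} {K : SimpleGraph B} {G : SimpleGraph V}
    {S : Set V} (hH : IsMinorOf H (G.induce S)) (hK : IsMinorOf K (G.induce Sᶜ)) :
    IsMinorOf (H.sum K) G := by
  have hsum : IsMinorOf (H.sum K) ((G.induce S).sum (G.induce Sᶜ)) := by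
    obtain ⟨f, hfc, hfd, hfa⟩ := hH
    obtain ⟨g, hgc, hgd, hga⟩ := hK
    have hinl : ∀ T : Set S, ((G.induce S).induce T).Connected →
        (((G.induce S).sum (G.induce Sᶜ)).induce (Sum.inl '' T)).Connected := by
      intro T hT
      refine hT.map ⟨fun x => ⟨Sum.inl x.1, x.1, x.2, rfl⟩, fun h => h⟩ ?_
      rintro ⟨_, x, hx, rfl⟩
      exact ⟨⟨x, hx⟩, rfl⟩
    have hinr : ∀ T : Set ↥Sᶜ, ((G.induce Sᶜ).induce T).Connected →
        (((G.induce S).sum (G.induce Sᶜ)).induce (Sum.inr '' T)).Connected := by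
      intro T hT
      refine hT.map ⟨fun x => ⟨Sum.inr x.1, x.1, x.2, rfl⟩, fun h => h⟩ ?_
      rintro ⟨_, x, hx, rfl⟩
      exact ⟨⟨x, hx⟩, rfl⟩
    refine ⟨Sum.elim (fun a => Sum.inl '' f a) (fun b => Sum.inr '' g b), ?_, ?_, ?_⟩
    · rintro (a | b)
      · exact hinl _ (hfc a)
      · exact hinr _ (hgc b)
    · rintro (a | b) (a' | b') h
      · exact (Set.disjoint_image_iff Sum.inl_injective).2 (hfd fun h' => h (h' ▸ rfl))
      · exact Set.disjoint_left.2 (by simp)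
      · exact Set.disjoint_left.2 (by simp)
      · exact (Set.disjoint_image_iff Sum.inr_injective).2 (hgd fun h' => h (h' ▸ rfl))
    · rintro (a | b) (a' | b') h
      · obtain ⟨x, hx, y, hy, hxy⟩ := hfa h
        exact ⟨_, ⟨x, hx, rfl⟩, _, ⟨y, hy, rfl⟩, hxy⟩
      · cases h
      · cases h
      · obtain ⟨x, hx, y, hy, hxy⟩ := hga h
        exact ⟨_, ⟨x, hx, rfl⟩, _, ⟨y, hy, rfl⟩, hxy⟩
  refine hsum.trans (isMinorOf_of_injective (Sum.elim (↑) (↑)) ?_ ?_)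
  · rintro (a | b) (a' | b') h
    · exact congrArg _ (Subtype.ext h)
    · exact absurd (Set.mem_of_eq_of_mem (Eq.symm h : (b' : V) = a) a.2) b'.2
    · exact absurd (Set.mem_of_eq_of_mem (h : (b : V) = a') a'.2) b.2
    · exact congrArg _ (Subtype.ext h)
  · rintro (a | b) (a' | b') h
    · exact h
    · cases h
    · cases h
    · exact h

/-- The contraction of the edge `uv` of `G`, with the resulting vertex called `u`. -/
def contraction {V : Type} (G : SimpleGraph V) (u v : V) : SimpleGraph ({v}ᶜ : Set V) :=
  SimpleGraph.fromRel fun x y => G.Adj x y ∨ ((x : V) = u ∧ G.Adj v y)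

theorem isMinorOf_contraction {V : Type} {G : SimpleGraph V} {u v : V} (huv : G.Adj u v) :
    IsMinorOf (contraction G u v) G := by
  classical
  have hadj : ∀ x y : ({v}ᶜ : Set V), (G.Adj x y ∨ ((x : V) = u ∧ G.Adj v y)) →
      ∃ a ∈ {z | z = (x : V) ∨ ((x : V) = u ∧ z = v)},
        ∃ b ∈ {z | z = (y : V) ∨ ((y : V) = u ∧ z = v)}, G.Adj a b := by
    rintro x y (h | ⟨hx, h⟩)
    · exact ⟨x, Or.inl rfl, y, Or.inl rfl, h⟩
    · exact ⟨v, Or.inr ⟨hx, rfl⟩, y, Or.inl rfl, h⟩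
  refine ⟨fun x => {z | z = (x : V) ∨ ((x : V) = u ∧ z = v)}, fun x => ?_, fun x y hxy => ?_,
    fun x y hxy => ?_⟩
  · by_cases hx : (x : V) = u
    · have hset : {z | z = (x : V) ∨ ((x : V) = u ∧ z = v)} = {u, v} := by
        ext z; simp [hx]
      beta_reduce
      rw [hset]
      exact induce_pair_connected_of_adj huv
    · have hset : {z | z = (x : V) ∨ ((x : V) = u ∧ z = v)} = {(x : V)} := by
        ext z; simp [hx]
      beta_reduce
      rw [hset]
      exact induce_singleton_connected G _
  · rw [Set.disjoint_left]
    have hx := x.2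
    have hy := y.2
    have hne : (x : V) ≠ y := fun h => hxy (Subtype.ext h)
    simp only [Set.mem_compl_iff, Set.mem_singleton_iff] at hx hy
    rintro z (rfl | ⟨h₁, rfl⟩) (h | ⟨h₂, h₃⟩)
    · exact hne h
    · exact hx h₃
    · exact hy h.symm
    · exact hne (h₁.trans h₂.symm)
  · rcases ((SimpleGraph.fromRel_adj _ _ _).1 hxy).2 with h | h
    · exact hadj x y h
    · obtain ⟨a, ha, b, hb, hab⟩ := hadj y x h
      exact ⟨b, hb, a, ha, hab.symm⟩

theorem OrientableOn.of_contraction {V : Type} {G : SimpleGraph V} {u v : V} (huv : G.Adj u v)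
    (hcommon : ∀ w, G.Adj u w → ¬ G.Adj v w) {s : Set ({v}ᶜ : Set V)}
    (hs : ∀ x ∈ s, (x : V) ≠ u) (h : OrientableOn (contraction G u v) sᶜ) :
    OrientableOn G ((↑) '' s)ᶜ := by
  classical
  obtain ⟨F, hF⟩ := h.exists_extension
  have huS : u ∉ (((↑) '' s) : Set V) := by
    rintro ⟨x, hx, hxu⟩
    exact hs x hx hxu
  have hmain : ∀ a b, a ≠ v → b ≠ v → a ∉ (((↑) '' s) : Set V) → b ∉ (((↑) '' s) : Set V) →
      a ≠ b → (G.Adj a b ∨ (a = u ∧ G.Adj v b)) → F a = b ∨ F b = a := by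
    intro a b ha hb has hbs hab h
    exact hF a b ha hb (fun h => has ⟨_, h, rfl⟩) (fun h => hbs ⟨_, h, rfl⟩)
      ((SimpleGraph.fromRel_adj _ _ _).2 ⟨fun h => hab (congrArg Subtype.val h), Or.inl h⟩)
  obtain ⟨f', hf'⟩ : ∃ f' : V → V, ∀ a, f' a = if a = v then (if G.Adj v (F u) then F u else u)
    else if a = u then (if G.Adj v (F u) then v else F u)
    else if F a = u then (if G.Adj v a then v else u) else F a := ⟨_, fun _ => rfl⟩
  have hv : ∀ b, b ∉ (((↑) '' s) : Set V) → G.Adj v b → f' v = b ∨ f' b = v := by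
    intro b hb hvb
    by_cases hbu : b = u
    · grind
    · have := hmain u b huv.ne hvb.ne.symm huS hb (Ne.symm hbu) (Or.inr ⟨rfl, hvb⟩)
      have := hvb.ne
      grind
  have hu : ∀ b, b ≠ v → b ∉ (((↑) '' s) : Set V) → G.Adj u b → f' u = b ∨ f' b = u := by
    intro b hbv hb hub
    have := hmain u b huv.ne hbv huS hb hub.ne (Or.inl hub)
    have := hub.ne
    have := huv.ne
    have := hcommon b hub
    grind
  refine ⟨f', fun a b ha hb hab => ?_⟩
  by_cases hav : a = v
  · subst hav
    exact hv b hb hab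
  by_cases hbv : b = v
  · subst hbv
    exact (hv a ha hab.symm).symm
  by_cases hau : a = u
  · subst hau
    exact hu b hbv hb hab
  by_cases hbu : b = u
  · subst hbu
    exact (hu a hav ha hab.symm).symm
  have := hmain a b hav hbv ha hb hab.ne (Or.inl hab)
  grind

/-- The diamond: `K₄` minus one edge. -/
def diamond : SimpleGraph (Fin 4) := mkGraph 4 [(0,1),(0,2),(0,3),(1,2),(1,3)]

/-- The butterfly: two triangles sharing exactly one vertex. -/
def butterfly : SimpleGraph (Fin 5) := mkGraph 5 [(0,1),(0,2),(1,2),(0,3),(0,4),(3,4)]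

theorem isMinorOf_diamond {V : Type} {G : SimpleGraph V} {u v w x : V} (huv : G.Adj u v)
    (huw : G.Adj u w) (hvw : G.Adj v w) (hux : G.Adj u x) (hvx : G.Adj v x) (hwx : w ≠ x) :
    IsMinorOf diamond G := by
  refine isMinorOf_of_injective ![u, v, w, x] ?_ ?_
  · have := huv.ne
    have := huw.ne
    have := hvw.ne
    have := hux.ne
    have := hvx.ne
    intro i j
    fin_cases i <;> fin_cases j <;> simp <;> grind
  · intro i j
    fin_cases i <;> fin_cases j <;>
      simp [diamond, mkGraph, huv, huw, hvw, hux, hvx, huv.symm, huw.symm, hvw.symm, hux.symm,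
        hvx.symm]

theorem isMinorOf_butterfly {V : Type} {G : SimpleGraph V} {a b c x y : V} (hab : G.Adj a b)
    (hac : G.Adj a c) (hbc : G.Adj b c) (hax : G.Adj a x) (hay : G.Adj a y) (hxy : G.Adj x y)
    (hbx : b ≠ x) (hby : b ≠ y) (hcx : c ≠ x) (hcy : c ≠ y) :
    IsMinorOf butterfly G := by
  refine isMinorOf_of_injective ![a, b, c, x, y] ?_ ?_
  · have := hab.ne
    have := hac.ne
    have := hbc.ne
    have := hax.ne
    have := hay.ne
    have := hxy.ne
    intro i j
    fin_cases i <;> fin_cases j <;> simp <;> grind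
  · intro i j
    fin_cases i <;> fin_cases j <;>
      simp [butterfly, mkGraph, hab, hac, hbc, hax, hay, hxy, hab.symm, hac.symm, hbc.symm,
        hax.symm, hay.symm, hxy.symm]

theorem diamond_or_butterfly_of_triangle {V : Type} {G : SimpleGraph V}
    (hG : ∀ u v, G.Adj u v → ∃ w, G.Adj u w ∧ G.Adj v w) {a b c x : V} (hab : G.Adj a b)
    (hac : G.Adj a c) (hbc : G.Adj b c) (hax : G.Adj a x) (hxb : x ≠ b) (hxc : x ≠ c) :
    IsMinorOf diamond G ∨ IsMinorOf butterfly G := by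
  obtain ⟨y, hay, hxy⟩ := hG a x hax
  by_cases hyb : y = b
  · subst hyb
    exact Or.inl (isMinorOf_diamond hab hac hbc hax hxy.symm hxc.symm)
  by_cases hyc : y = c
  · subst hyc
    exact Or.inl (isMinorOf_diamond hac hab hbc.symm hax hxy.symm hxb.symm)
  exact Or.inr (isMinorOf_butterfly hab hac hbc hax hay hxy hxb.symm (Ne.symm hyb) hxc.symm
    (Ne.symm hyc))

theorem natCard_compl_singleton_lt {V : Type} [Finite V] (v : V) :
    Nat.card ({v}ᶜ : Set V) < Nat.card V :=
  Finite.card_subtype_lt (p := (· ∈ ({v}ᶜ : Set V))) (x := v) (by simp)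

theorem diamond_or_butterfly_of_not_orientableOn {V : Type} [Finite V] {G : SimpleGraph V}
    (hG : ¬ OrientableOn G Set.univ) : IsMinorOf diamond G ∨ IsMinorOf butterfly G := by
  classical
  induction hn : Nat.card V using Nat.strong_induction_on generalizing V with
  | _ n ih =>
  subst hn
  by_cases htri : ∀ u v, G.Adj u v → ∃ w, G.Adj u w ∧ G.Adj v w
  swap
  · push Not at htri
    obtain ⟨u, v, huv, hcommon⟩ := htri
    have hcon : ¬ OrientableOn (contraction G u v) Set.univ := by
      intro h
      have := OrientableOn.of_contraction huv hcommon (s := ∅) (by simp) (by simpa using h)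
      exact hG (by simpa using this)
    exact (ih _ (natCard_compl_singleton_lt v) hcon rfl).imp
      (·.trans (isMinorOf_contraction huv)) (·.trans (isMinorOf_contraction huv))
  by_cases hedge : ∃ u v, G.Adj u v
  swap
  · push Not at hedge
    exact absurd ⟨id, fun a b _ _ h => absurd h (hedge a b)⟩ hG
  obtain ⟨u, v, huv⟩ := hedge
  obtain ⟨w, huw, hvw⟩ := htri u v huv
  by_cases hu : ∃ x, G.Adj u x ∧ x ≠ v ∧ x ≠ w
  · obtain ⟨x, hx, hxv, hxw⟩ := hu
    exact diamond_or_butterfly_of_triangle htri huv huw hvw hx hxv hxw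
  by_cases hv : ∃ x, G.Adj v x ∧ x ≠ u ∧ x ≠ w
  · obtain ⟨x, hx, hxu, hxw⟩ := hv
    exact diamond_or_butterfly_of_triangle htri huv.symm hvw huw hx hxu hxw
  by_cases hw : ∃ x, G.Adj w x ∧ x ≠ u ∧ x ≠ v
  · obtain ⟨x, hx, hxu, hxv⟩ := hw
    exact diamond_or_butterfly_of_triangle htri huw.symm hvw.symm huv hx hxu hxv
  have hdel : ¬ OrientableOn (G.induce {u}ᶜ) Set.univ := by
    rw [orientableOn_induce_iff]
    rintro ⟨f, hf⟩
    have hne₁ := huv.ne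
    have hne₂ := huw.ne
    have hne₃ := hvw.ne
    refine hG ⟨fun a => if a = u then v else if a = v then w else if a = w then u else f a,
      fun a b _ _ hab => ?_⟩
    have hsym := hab.symm
    have hfab := hf (a := a) (b := b)
    have hne := hab.ne
    simp only [Set.mem_compl_iff, Set.mem_singleton_iff] at hfab
    grind
  exact (ih _ (natCard_compl_singleton_lt u) hdel rfl).imp
    (·.trans (isMinorOf_induce G _)) (·.trans (isMinorOf_induce G _))

theorem not_orientableOn_of_diamond {V : Type} {G : SimpleGraph V} {S : Set V} {u v w x : V}
    (hS : u ∈ S ∧ v ∈ S ∧ w ∈ S ∧ x ∈ S) (huv : G.Adj u v) (huw : G.Adj u w)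
    (hvw : G.Adj v w) (hux : G.Adj u x) (hvx : G.Adj v x) (hwx : w ≠ x) :
    ¬ OrientableOn G S := by
  rintro ⟨f, hf⟩
  obtain ⟨hu, hv, hw, hx⟩ := hS
  have h₁ := hf hu hv huv
  have h₂ := hf hu hw huw
  have h₃ := hf hv hw hvw
  have h₄ := hf hu hx hux
  have h₅ := hf hv hx hvx
  have := huv.ne
  have := huw.ne
  have := hvw.ne
  have := hux.ne
  have := hvx.ne
  grind

theorem not_orientableOn_of_butterfly {V : Type} {G : SimpleGraph V} {S : Set V} {a b c x y : V}
    (hS : a ∈ S ∧ b ∈ S ∧ c ∈ S ∧ x ∈ S ∧ y ∈ S) (hab : G.Adj a b)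
    (hac : G.Adj a c) (hbc : G.Adj b c) (hax : G.Adj a x) (hay : G.Adj a y) (hxy : G.Adj x y)
    (hbx : b ≠ x) (hby : b ≠ y) (hcx : c ≠ x) (hcy : c ≠ y) : ¬ OrientableOn G S := by
  rintro ⟨f, hf⟩
  obtain ⟨ha, hb, hc, hx, hy⟩ := hS
  have h₁ := hf ha hb hab
  have h₂ := hf ha hc hac
  have h₃ := hf hb hc hbc
  have h₄ := hf ha hx hax
  have h₅ := hf ha hy hay
  have h₆ := hf hx hy hxy
  have := hab.ne
  have := hac.ne
  have := hbc.ne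
  have := hax.ne
  have := hay.ne
  have := hxy.ne
  grind

theorem OrientableOn.mono {V : Type} {G : SimpleGraph V} {S T : Set V} (h : OrientableOn G T)
    (hST : S ⊆ T) : OrientableOn G S :=
  h.imp fun _ hf _ _ ha hb => hf (hST ha) (hST hb)

theorem not_apexPseudoforest_of_split {V : Type} {G : SimpleGraph V} (A : Set V)
    (h₁ : ¬ OrientableOn G A) (h₂ : ¬ OrientableOn G Aᶜ) : ¬ ApexPseudoforest G := by
  rw [apexPseudoforest_iff]
  rintro ⟨s, hs, h⟩
  have h₁' : ∃ a ∈ A, a ∈ s := by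
    by_contra! hA
    exact h₁ (h.mono hA)
  have h₂' : ∃ a ∈ Aᶜ, a ∈ s := by
    by_contra! hA
    exact h₂ (h.mono hA)
  obtain ⟨a, ha, has⟩ := h₁'
  obtain ⟨b, hb, hbs⟩ := h₂'
  exact hb (hs has hbs ▸ ha)

theorem not_apexPseudoforest_O1 : ¬ ApexPseudoforest O1 :=
  not_apexPseudoforest_of_split {i | i < 4}
    (not_orientableOn_of_diamond (u := 0) (v := 1) (w := 2) (x := 3) (by simp)
      (by simp [O1, mkGraph]) (by simp [O1, mkGraph]) (by simp [O1, mkGraph])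
      (by simp [O1, mkGraph]) (by simp [O1, mkGraph]) (by decide))
    (not_orientableOn_of_diamond (u := 4) (v := 5) (w := 6) (x := 7) (by simp)
      (by simp [O1, mkGraph]) (by simp [O1, mkGraph]) (by simp [O1, mkGraph])
      (by simp [O1, mkGraph]) (by simp [O1, mkGraph]) (by decide))

theorem not_apexPseudoforest_O2 : ¬ ApexPseudoforest O2 :=
  not_apexPseudoforest_of_split {i | i < 5}
    (not_orientableOn_of_butterfly (a := 0) (b := 1) (c := 2) (x := 3) (y := 4) (by simp)
      (by simp [O2, mkGraph]) (by simp [O2, mkGraph]) (by simp [O2, mkGraph])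
      (by simp [O2, mkGraph]) (by simp [O2, mkGraph]) (by simp [O2, mkGraph])
      (by decide) (by decide) (by decide) (by decide))
    (not_orientableOn_of_butterfly (a := 5) (b := 6) (c := 7) (x := 8) (y := 9) (by simp)
      (by simp [O2, mkGraph]) (by simp [O2, mkGraph]) (by simp [O2, mkGraph])
      (by simp [O2, mkGraph]) (by simp [O2, mkGraph]) (by simp [O2, mkGraph])
      (by decide) (by decide) (by decide) (by decide))

theorem not_apexPseudoforest_O3 : ¬ ApexPseudoforest O3 :=
  not_apexPseudoforest_of_split {i | i < 4}
    (not_orientableOn_of_diamond (u := 0) (v := 1) (w := 2) (x := 3) (by simp)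
      (by simp [O3, mkGraph]) (by simp [O3, mkGraph]) (by simp [O3, mkGraph])
      (by simp [O3, mkGraph]) (by simp [O3, mkGraph]) (by decide))
    (not_orientableOn_of_butterfly (a := 4) (b := 5) (c := 6) (x := 7) (y := 8) (by simp)
      (by simp [O3, mkGraph]) (by simp [O3, mkGraph]) (by simp [O3, mkGraph])
      (by simp [O3, mkGraph]) (by simp [O3, mkGraph]) (by simp [O3, mkGraph])
      (by decide) (by decide) (by decide) (by decide))

instance mkGraph.instDecidableRelAdj (n : ℕ) (E : List (ℕ × ℕ)) :
    DecidableRel (mkGraph n E).Adj := fun _ _ =>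
  decidable_of_iff' _ (SimpleGraph.fromRel_adj _ _ _)

instance SimpleGraph.sum.instDecidableRelAdj {A B : Type} (H : SimpleGraph A) (K : SimpleGraph B)
    [DecidableRel H.Adj] [DecidableRel K.Adj] : DecidableRel (H.sum K).Adj := fun i j =>
  match i, j with
  | Sum.inl a, Sum.inl b => inferInstanceAs (Decidable (H.Adj a b))
  | Sum.inr a, Sum.inr b => inferInstanceAs (Decidable (K.Adj a b))
  | Sum.inl _, Sum.inr _ => isFalse (fun h => nomatch h)
  | Sum.inr _, Sum.inl _ => isFalse (fun h => nomatch h)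

theorem isMinorOf_O1 : IsMinorOf O1 (diamond.sum diamond) :=
  isMinorOf_of_injective _ (finSumFinEquiv (m := 4) (n := 4)).symm.injective (by
    unfold O1 diamond
    decide)

theorem isMinorOf_O2 : IsMinorOf O2 (butterfly.sum butterfly) :=
  isMinorOf_of_injective _ (finSumFinEquiv (m := 5) (n := 5)).symm.injective (by
    unfold O2 butterfly
    decide)

theorem isMinorOf_O3 : IsMinorOf O3 (diamond.sum butterfly) :=
  isMinorOf_of_injective _ (finSumFinEquiv (m := 4) (n := 5)).symm.injective (by
    unfold O3 diamond butterfly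
    decide)

theorem inO_of_obsApexPseudoforest_of_isMinorOf {V : Type} {G : SimpleGraph V}
    (hG : ObsApexPseudoforest G) {n : ℕ} {H : SimpleGraph (Fin n)} (hmem : ⟨n, H⟩ ∈ OList)
    (hH : ¬ ApexPseudoforest H) (hHG : IsMinorOf H G) : InO G := by
  by_contra hO
  refine hH (hG.2 (Fin n) H hHG ⟨fun e => hO ⟨⟨n, H⟩, hmem, ⟨e.symm⟩⟩⟩)

theorem inO_of_split {V : Type} [Finite V] {G : SimpleGraph V} (hG : ObsApexPseudoforest G)
    {S : Set V} (h₁ : ¬ OrientableOn G S) (h₂ : ¬ OrientableOn G Sᶜ) : InO G := by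
  have hmem₁ : ⟨8, O1⟩ ∈ OList := by simp [OList]
  have hmem₂ : ⟨10, O2⟩ ∈ OList := by simp [OList]
  have hmem₃ : ⟨9, O3⟩ ∈ OList := by simp [OList]
  rw [← orientableOn_induce_iff] at h₁ h₂
  rcases diamond_or_butterfly_of_not_orientableOn h₁ with d₁ | b₁ <;>
    rcases diamond_or_butterfly_of_not_orientableOn h₂ with d₂ | b₂
  · exact inO_of_obsApexPseudoforest_of_isMinorOf hG hmem₁ not_apexPseudoforest_O1
      (isMinorOf_O1.trans (isMinorOf_sum d₁ d₂))
  · exact inO_of_obsApexPseudoforest_of_isMinorOf hG hmem₃ not_apexPseudoforest_O3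
      (isMinorOf_O3.trans (isMinorOf_sum d₁ b₂))
  · rw [← compl_compl S] at b₁
    exact inO_of_obsApexPseudoforest_of_isMinorOf hG hmem₃ not_apexPseudoforest_O3
      (isMinorOf_O3.trans (isMinorOf_sum d₂ b₁))
  · exact inO_of_obsApexPseudoforest_of_isMinorOf hG hmem₂ not_apexPseudoforest_O2
      (isMinorOf_O2.trans (isMinorOf_sum b₁ b₂))

theorem ObsApexPseudoforest.exists_orientableOn {V W : Type} [Finite V] [Finite W]
    {G : SimpleGraph V} (hG : ObsApexPseudoforest G) {H : SimpleGraph W} (hH : IsMinorOf H G)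
    (hcard : Nat.card W < Nat.card V) : ∃ s : Set W, s.Subsingleton ∧ OrientableOn H sᶜ :=
  apexPseudoforest_iff.1 (hG.2 W H hH ⟨fun e => hcard.ne (Nat.card_congr e.toEquiv)⟩)

theorem ObsApexPseudoforest.not_orientableOn {V : Type} {G : SimpleGraph V}
    (hG : ObsApexPseudoforest G) {s : Set V} (hs : s.Subsingleton) : ¬ OrientableOn G sᶜ :=
  fun h => hG.1 (apexPseudoforest_iff.2 ⟨s, hs, h⟩)

theorem ObsApexPseudoforest.orientableOn_compl_pair {V : Type} [Finite V] {G : SimpleGraph V}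
    (hG : ObsApexPseudoforest G) {u v : V} (huv : G.Adj u v)
    (hcommon : ∀ w, G.Adj u w → ¬ G.Adj v w) : OrientableOn G {u, v}ᶜ := by
  obtain ⟨s, hs, h⟩ :=
    hG.exists_orientableOn (isMinorOf_contraction huv) (natCard_compl_singleton_lt v)
  by_cases hu : ∃ x ∈ s, (x : V) = u
  · obtain ⟨x, hx, hxu⟩ := hu
    obtain ⟨F, hF⟩ := h.exists_extension
    have hmem : ∀ {a} (ha : a ∈ ({v}ᶜ : Set V)), a ≠ u → ⟨a, ha⟩ ∈ sᶜ := fun ha hau has =>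
      hau ((congrArg Subtype.val (hs has hx)).trans hxu)
    refine ⟨F, fun a b ha hb hab => ?_⟩
    simp only [Set.mem_compl_iff, Set.mem_insert_iff, Set.mem_singleton_iff, not_or] at ha hb
    exact hF a b ha.2 hb.2 (hmem ha.2 ha.1) (hmem hb.2 hb.1)
      ((SimpleGraph.fromRel_adj _ _ _).2
        ⟨fun h => hab.ne (congrArg Subtype.val h), Or.inl (Or.inl hab)⟩)
  · push Not at hu
    exact absurd (OrientableOn.of_contraction huv hcommon hu h)
      (hG.not_orientableOn (hs.image _))

theorem ObsApexPseudoforest.two_le_ncard_neighborSet {V : Type} [Finite V] {G : SimpleGraph V}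
    (hG : ObsApexPseudoforest G) (v : V) : 2 ≤ (G.neighborSet v).ncard := by
  classical
  by_contra! hlt
  have hsub : ∀ a b, G.Adj v a → G.Adj v b → a = b := fun a b ha hb =>
    (Set.ncard_le_one (Set.toFinite _)).1 (Nat.le_of_lt_succ hlt) a ha b hb
  obtain ⟨s, hs, h⟩ :=
    hG.exists_orientableOn (isMinorOf_induce G {v}ᶜ) (natCard_compl_singleton_lt v)
  obtain ⟨F, hF⟩ := h.exists_extension
  obtain ⟨w, hw⟩ : ∃ w, ∀ a, G.Adj v a → a = w := by
    by_cases h : ∃ w, G.Adj v w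
    · exact h.imp fun w hw a ha => hsub a w ha hw
    · exact ⟨v, fun a ha => absurd ⟨a, ha⟩ h⟩
  refine hG.not_orientableOn (hs.image ((↑) : _ → V))
    ⟨fun a => if a = v then w else F a, fun a b ha hb hab => ?_⟩
  by_cases hav : a = v
  · subst hav
    simp [hw b hab]
  by_cases hbv : b = v
  · subst hbv
    simp [hw a hab.symm]
  simpa [hav, hbv] using hF a b hav hbv (fun h => ha ⟨_, h, rfl⟩) (fun h => hb ⟨_, h, rfl⟩) hab

theorem ObsApexPseudoforest.isSimplicial_of_ncard_eq_two {V : Type} [Finite V]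
    {G : SimpleGraph V} (hG : ObsApexPseudoforest G) {v : V}
    (hv : (G.neighborSet v).ncard = 2) {a b : V} (ha : G.Adj v a) (hb : G.Adj v b)
    (hab : a ≠ b) : G.Adj a b := by
  classical
  have hnbr : ∀ w, G.Adj v w → w = a ∨ w = b := by
    intro w hw
    have hset : ({a, b} : Set V) = G.neighborSet v :=
      Set.eq_of_subset_of_ncard_le (by rintro x (rfl | rfl) <;> assumption)
        (by rw [hv, Set.ncard_pair hab])
    have : w ∈ ({a, b} : Set V) := hset ▸ hw
    simpa using this
  by_contra hnadj
  obtain ⟨f, hf⟩ := hG.orientableOn_compl_pair ha (by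
    intro w hw haw
    rcases hnbr w hw with rfl | rfl
    · exact haw.ne rfl
    · exact hnadj haw)
  refine hG.not_orientableOn (Set.subsingleton_singleton (a := a))
    ⟨fun x => if x = v then b else f x, fun x y hx hy hxy => ?_⟩
  have := hf (a := x) (b := y)
  have := hxy.symm
  have := hxy.ne
  simp only [Set.mem_compl_iff, Set.mem_insert_iff, Set.mem_singleton_iff] at *
  grind

theorem ObsApexPseudoforest.inO_of_not_reachable {V : Type} [Finite V] {G : SimpleGraph V}
    (hG : ObsApexPseudoforest G) {u v : V} (huv : G.Adj u v)
    (hr : ¬ (G.deleteEdges {s(u, v)}).Reachable u v) : InO G := by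
  classical
  obtain ⟨S, hu, hv, hcross⟩ : ∃ S : Set V, u ∈ S ∧ v ∉ S ∧
      ∀ x y, x ∈ S → y ∉ S → G.Adj x y → x = u ∧ y = v := by
    refine ⟨{x | (G.deleteEdges {s(u, v)}).Reachable u x}, Reachable.refl u, hr,
      fun x y hx hy hxy => ?_⟩
    by_cases he : s(x, y) = s(u, v)
    · rcases Sym2.eq_iff.1 he with h | ⟨rfl, rfl⟩
      · exact h
      · exact absurd hx hr
    · exact absurd (hx.trans (Adj.reachable (deleteEdges_adj.2 ⟨hxy, he⟩))) hy
  have hne := huv.ne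
  have h_out : ∀ z, z ∉ S → z ≠ u := fun z hz h => hz (h ▸ hu)
  have h_in : ∀ z, z ∈ S → z ≠ v := fun z hz h => hv (h ▸ hz)
  obtain ⟨f, hf⟩ := hG.orientableOn_compl_pair huv (by
    intro w huw hvw
    by_cases hw : w ∈ S
    · exact huw.ne (hcross w v hw hv hvw.symm).1.symm
    · exact hvw.ne (hcross u w hu hw huw).2.symm)
  refine inO_of_split hG (S := S) ?_ ?_
  · rintro ⟨g, hg⟩
    refine hG.not_orientableOn (Set.subsingleton_singleton (a := v))
      ⟨fun x => if x ∈ S then g x else f x, fun x y hx hy hxy => ?_⟩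
    have h₁ := hf (a := x) (b := y)
    have h₂ := hg (a := x) (b := y)
    have h₃ := hcross x y
    have h₄ := hcross y x
    have h₅ := hxy.symm
    have h₆ := h_out x
    have h₇ := h_out y
    have h₈ := h_in x
    have h₉ := h_in y
    simp only [Set.mem_compl_iff, Set.mem_insert_iff, Set.mem_singleton_iff] at *
    by_cases hxS : x ∈ S <;> by_cases hyS : y ∈ S <;> simp only [hxS, hyS] at * <;> grind
  · rintro ⟨g, hg⟩
    refine hG.not_orientableOn (Set.subsingleton_singleton (a := u))
      ⟨fun x => if x ∈ S then f x else g x, fun x y hx hy hxy => ?_⟩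
    have h₁ := hf (a := x) (b := y)
    have h₂ := hg (a := x) (b := y)
    have h₃ := hcross x y
    have h₄ := hcross y x
    have h₅ := hxy.symm
    have h₆ := h_out x
    have h₇ := h_out y
    have h₈ := h_in x
    have h₉ := h_in y
    simp only [Set.mem_compl_iff, Set.mem_insert_iff, Set.mem_singleton_iff] at *
    by_cases hxS : x ∈ S <;> by_cases hyS : y ∈ S <;> simp only [hxS, hyS] at * <;> grind

theorem card_connectedComponent_deleteEdges_le {V : Type} [Finite V] {G : SimpleGraph V}
    {u v : V} (hr : (G.deleteEdges {s(u, v)}).Reachable u v) :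
    Nat.card (G.deleteEdges {s(u, v)}).ConnectedComponent ≤ Nat.card G.ConnectedComponent := by
  have hreach : ∀ {x y}, G.Reachable x y → (G.deleteEdges {s(u, v)}).Reachable x y := by
    rintro x y ⟨p⟩
    induction p with
    | nil => exact Reachable.refl _
    | @cons a b c hab p ih =>
      refine Reachable.trans ?_ ih
      by_cases he : s(a, b) = s(u, v)
      · rcases Sym2.eq_iff.1 he with ⟨rfl, rfl⟩ | ⟨rfl, rfl⟩
        · exact hr
        · exact hr.symm
      · exact Adj.reachable (deleteEdges_adj.2 ⟨hab, he⟩)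
  refine Nat.card_le_card_of_injective
    (ConnectedComponent.map (Hom.ofLE (deleteEdges_le _))) ?_
  intro C D
  induction C using ConnectedComponent.ind
  induction D using ConnectedComponent.ind
  intro h
  exact ConnectedComponent.sound (hreach (ConnectedComponent.exact h))

/-- Every obstruction for apex-pseudoforests not isomorphic to a member of `O` has
minimum degree at least 2, has no bridge, and all its degree-2 vertices are simplicial. -/
theorem obstruction_degree_bridge_simplicial {V : Type} [Finite V] (G : SimpleGraph V)
    (h1 : ObsApexPseudoforest G) (h2 : ¬ InO G) :
    (∀ v : V, 2 ≤ (G.neighborSet v).ncard) ∧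
    (¬ ∃ e : Sym2 V, e ∈ G.edgeSet ∧
        Nat.card G.ConnectedComponent <
          Nat.card (G.deleteEdges {e}).ConnectedComponent) ∧
    (∀ v : V, (G.neighborSet v).ncard = 2 →
      ∀ a ∈ G.neighborSet v, ∀ b ∈ G.neighborSet v, a ≠ b → G.Adj a b) := by
  refine ⟨h1.two_le_ncard_neighborSet, ?_,
    fun v hv a ha b hb hab => h1.isSimplicial_of_ncard_eq_two hv ha hb hab⟩
  rintro ⟨e, he, hlt⟩
  induction e with | h u v => ?_
  by_cases hr : (G.deleteEdges {s(u, v)}).Reachable u v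
  · exact (card_connectedComponent_deleteEdges_le hr).not_gt hlt
  · exact h2 (h1.inO_of_not_reachable he hr)
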